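/- Let κ ≥ 1, let H : ℝ^d → ℝ be (κ+1) times continuously differentiable, and let ḡ : ℝ^d × ℝ^d → ℝ^d satisfy the discrete gradient condition ⟨ḡ(x,y), y−x⟩ = H(y) − H(x) for all x, y, with y ↦ ḡ(x,y) κ times continuously differentiable. Then for all x ∈ ℝ^d and all u, v₁, …, v_κ ∈ ℝ^d, ⟨D^κ∇H(x)(v₁,…,v_κ), u⟩ = ⟨D₂^κḡ(x,x)(v₁,…,v_κ), u⟩ + Σ_{m=1}^κ ⟨D₂^κḡ(x,x)(v₁,…,v_{m−1}, u, v_{m+1},…,v_κ), v_m⟩, where D₂^κḡ(x,x) denotes the κ-th derivative of y ↦ ḡ(x,y) at y = x and D^κ∇H(x) the κ-th derivative of ∇H at x. -/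

import Mathlib

open scoped RealInnerProductSpace

/-- Lower-order remainder in the Leibniz formula. -/
noncomputable def dgRem {E : Type*} [NormedAddCommGroup E] [InnerProductSpace ℝ E]
    (c : ℝ) (g : E → E) : (k : ℕ) → E → (Fin k → E) → ℝ
  | 0, _, _ => c
  | j + 1, y, v => ∑ m : Fin (j + 1), ⟪iteratedFDeriv ℝ j g y (m.removeNth v), v m⟫

theorem dg_line {E F : Type*} [NormedAddCommGroup E] [NormedSpace ℝ E]
    [NormedAddCommGroup F] [NormedSpace ℝ F] (f : E → F) (k : ℕ) (hf : ContDiff ℝ (k + 1) f)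
    (y a : E) (t : Fin k → E) :
    HasDerivAt (fun s : ℝ => iteratedFDeriv ℝ k f (y + s • a) t)
      (iteratedFDeriv ℝ (k + 1) f y (Fin.cons a t)) 0 := by
  have hd : DifferentiableAt ℝ (iteratedFDeriv ℝ k f) (y + (0 : ℝ) • a) :=
    (hf.differentiable_iteratedFDeriv (by exact_mod_cast Nat.lt_succ_self k)) _
  have hl : HasDerivAt (fun s : ℝ => y + s • a) a 0 := by
    simpa using ((hasDerivAt_id (0 : ℝ)).smul_const a).const_add y
  have h1 := hd.hasFDerivAt.comp_hasDerivAt (0 : ℝ) hl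
  have h2 := (ContinuousMultilinearMap.apply ℝ (fun _ : Fin k => E) F t).hasFDerivAt.comp_hasDerivAt
    (0 : ℝ) h1
  convert h2 using 1
  · rfl
  rw [iteratedFDeriv_succ_apply_left, zero_smul, add_zero]
  simp [ContinuousMultilinearMap.apply]

theorem dg_swap {E F : Type*} [NormedAddCommGroup E] [NormedSpace ℝ E]
    [NormedAddCommGroup F] [NormedSpace ℝ F] (f : E → F) (n : ℕ)
    (hf : ContDiff ℝ ((n + 1 : ℕ) : WithTop ℕ∞) f) (i : Fin n) :
    ∀ (y : E) (v : Fin (n + 1) → E),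
    iteratedFDeriv ℝ (n + 1) f y (v ∘ Equiv.swap i.castSucc i.succ)
      = iteratedFDeriv ℝ (n + 1) f y v := by
  induction n with
  | zero => exact i.elim0
  | succ n ih =>
    intro y v
    induction i using Fin.cases with
    | zero =>
      have key : ∀ w : Fin (n + 2) → E, iteratedFDeriv ℝ (n + 2) f y w =
          fderiv ℝ (fderiv ℝ (iteratedFDeriv ℝ n f)) y (w 0) (w 1) (Fin.tail (Fin.tail w)) := by
        intro w
        rw [iteratedFDeriv_succ_apply_left, iteratedFDeriv_succ_eq_comp_left]
        have hc := LinearIsometryEquiv.comp_fderiv (𝕜 := ℝ)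
          (F := ContinuousMultilinearMap ℝ (fun _ : Fin (n + 1) => E) F)
          (continuousMultilinearCurryLeftEquiv ℝ (fun _ : Fin (n + 1) => E) F).symm
          (f := fderiv ℝ (iteratedFDeriv ℝ n f)) (x := y)
        exact congrArg (fun L => L (w 0) (Fin.tail w)) hc
      have hG : ContDiff ℝ 2 (iteratedFDeriv ℝ n f) :=
        hf.iteratedFDeriv_right (by norm_cast; omega)
      have hs := hG.contDiffAt.isSymmSndFDerivAt (x := y) (by simp)
      rw [key, key]
      have e : Fin.tail (Fin.tail (v ∘ Equiv.swap (Fin.castSucc (0 : Fin (n + 1))) (Fin.succ 0)))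
          = Fin.tail (Fin.tail v) := by
        funext j
        simp only [Fin.tail, Function.comp]
        rw [Equiv.swap_apply_of_ne_of_ne]
        · simp [Fin.ext_iff]
        · simp [Fin.ext_iff]
      rw [e]
      have e0 : (v ∘ Equiv.swap (Fin.castSucc (0 : Fin (n + 1))) (Fin.succ 0)) 0 = v 1 := by
        simp
      have e1 : (v ∘ Equiv.swap (Fin.castSucc (0 : Fin (n + 1))) (Fin.succ 0)) 1 = v 0 := by
        simp
      rw [e0, e1, hs (v 1) (v 0)]
    | succ j =>
      have hv : v = Fin.cons (v 0) (Fin.tail v) := (Fin.cons_self_tail v).symm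
      have hw : v ∘ Equiv.swap j.succ.castSucc j.succ.succ
          = Fin.cons (v 0) (Fin.tail v ∘ Equiv.swap j.castSucc j.succ) := by
        funext p
        induction p using Fin.cases with
        | zero =>
          simp only [Function.comp, Fin.cons_zero]
          rw [Equiv.swap_apply_of_ne_of_ne] <;> simp [Fin.ext_iff]
        | succ p =>
          simp only [Function.comp, Fin.cons_succ, Fin.tail, Equiv.swap_apply_def,
            Fin.ext_iff, Fin.val_succ, Fin.val_castSucc]
          congr 1
          split_ifs <;> first | rfl | omega
      have h1 := dg_line f (n + 1) (by exact_mod_cast hf) y (v 0) (Fin.tail v)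
      have h2 := dg_line f (n + 1) (by exact_mod_cast hf) y (v 0)
        (Fin.tail v ∘ Equiv.swap j.castSucc j.succ)
      simp only [ih (hf.of_le (by norm_cast; omega)) j] at h2
      rw [hw, h2.unique h1, ← hv]

theorem dg_symm {E F : Type*} [NormedAddCommGroup E] [NormedSpace ℝ E]
    [NormedAddCommGroup F] [NormedSpace ℝ F] (f : E → F) (n : ℕ)
    (hf : ContDiff ℝ n f) (σ : Equiv.Perm (Fin n)) (y : E) (v : Fin n → E) :
    iteratedFDeriv ℝ n f y (v ∘ σ) = iteratedFDeriv ℝ n f y v := by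
  cases n with
  | zero => congr 1; exact Subsingleton.elim _ _
  | succ n =>
    have hσ : σ ∈ Submonoid.closure
        (Set.range fun i : Fin n => Equiv.swap i.castSucc i.succ) := by
      rw [Equiv.Perm.mclosure_swap_castSucc_succ]; trivial
    induction hσ using Submonoid.closure_induction generalizing v with
    | mem s hs => obtain ⟨i, rfl⟩ := hs; exact dg_swap f n hf i y v
    | one => rfl
    | mul a b _ _ ha hb =>
      rw [Equiv.Perm.coe_mul, ← Function.comp_assoc, hb, ha]

theorem dg_removeNth_succ_cons {E : Type*} {j : ℕ} (m : Fin (j + 1)) (a : E)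
    (t : Fin (j + 1) → E) :
    m.succ.removeNth (Fin.cons a t : Fin (j + 2) → E)
      = (Fin.cons a (m.removeNth t) : Fin (j + 1) → E) := by
  funext i
  refine Fin.cases ?_ (fun i => ?_) i
  · simp [Fin.removeNth]
  · simp [Fin.removeNth]

theorem dg_rem_line {E : Type*} [NormedAddCommGroup E] [InnerProductSpace ℝ E]
    (c : ℝ) (g : E → E) (k : ℕ) (hg : ContDiff ℝ k g) (y a : E) (t : Fin k → E) :
    HasDerivAt (fun s : ℝ => dgRem c g k (y + s • a) t)
      (dgRem c g (k + 1) y (Fin.cons a t) - ⟪iteratedFDeriv ℝ k g y t, a⟫) 0 := by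
  cases k with
  | zero =>
    have : (Fin.removeNth 0 (Fin.cons a t : Fin 1 → E)) = t := Subsingleton.elim _ _
    simpa [dgRem, this] using hasDerivAt_const (0 : ℝ) c
  | succ j =>
    have e : dgRem c g (j + 1 + 1) y (Fin.cons a t) - ⟪iteratedFDeriv ℝ (j + 1) g y t, a⟫
        = ∑ m : Fin (j + 1),
          ⟪iteratedFDeriv ℝ (j + 1) g y (Fin.cons a (m.removeNth t)), t m⟫ := by
      rw [dgRem, Fin.sum_univ_succ]
      simp [dg_removeNth_succ_cons]
    rw [e]
    simp only [dgRem]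
    refine HasDerivAt.fun_sum fun m _ => ?_
    have h := dg_line g j (by exact_mod_cast hg) y a (m.removeNth t)
    simpa using h.inner ℝ (hasDerivAt_const (0 : ℝ) (t m))

theorem dg_formula {E : Type*} [NormedAddCommGroup E] [InnerProductSpace ℝ E]
    (H : E → ℝ) (g : E → E) (x : E) (n : ℕ) (hH : ContDiff ℝ n H) (hg : ContDiff ℝ n g)
    (h : ∀ y, ⟪g y, y - x⟫ = H y - H x) (k : ℕ) (hk : k ≤ n) :
    ∀ (y : E) (v : Fin k → E), iteratedFDeriv ℝ k H y v =
      ⟪iteratedFDeriv ℝ k g y v, y - x⟫ + dgRem (H x) g k y v := by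
  induction k with
  | zero => intro y v; simp [dgRem, h]
  | succ k ih =>
    intro y v
    have hk' : ((k : WithTop ℕ∞) + 1) ≤ n := by exact_mod_cast hk
    obtain ⟨a, t, rfl⟩ : ∃ a t, v = Fin.cons a t := ⟨v 0, Fin.tail v, (Fin.cons_self_tail v).symm⟩
    have h1 := dg_line H k (hH.of_le hk') y a t
    have h2 := dg_line g k (hg.of_le hk') y a t
    have h3 := dg_rem_line (H x) g k (hg.of_le (le_trans (by simp) hk')) y a t
    have hl : HasDerivAt (fun s : ℝ => y + s • a - x) a 0 := by
      simpa using (((hasDerivAt_id (0 : ℝ)).smul_const a).const_add y).sub_const x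
    have h4 := (h2.inner ℝ hl).add h3
    have h5 := h1.unique (h4.congr_of_eventuallyEq
      (Filter.Eventually.of_forall fun s => by simp [ih (by omega)]))
    rw [h5]
    simp
    ring

theorem dg_top {E : Type*} [NormedAddCommGroup E] [InnerProductSpace ℝ E]
    (H : E → ℝ) (g : E → E) (x : E) (n : ℕ) (hH : ContDiff ℝ (n + 1) H) (hg : ContDiff ℝ n g)
    (h : ∀ y, ⟪g y, y - x⟫ = H y - H x) (v : Fin (n + 1) → E) :
    iteratedFDeriv ℝ (n + 1) H x v =
      ∑ m : Fin (n + 1), ⟪iteratedFDeriv ℝ n g x (m.removeNth v), v m⟫ := by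
  obtain ⟨a, t, rfl⟩ : ∃ a t, v = Fin.cons a t := ⟨v 0, Fin.tail v, (Fin.cons_self_tail v).symm⟩
  have h1 := dg_line H n hH x a t
  have h3 := dg_rem_line (H x) g n hg x a t
  have h2 : HasDerivAt (fun s : ℝ => ⟪iteratedFDeriv ℝ n g (x + s • a) t, x + s • a - x⟫)
      ⟪iteratedFDeriv ℝ n g x t, a⟫ 0 := by
    have hc : Continuous (iteratedFDeriv ℝ n g) := hg.continuous_iteratedFDeriv le_rfl
    have hc2 : Continuous (fun s : ℝ => ⟪iteratedFDeriv ℝ n g (x + s • a) t, a⟫) := by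
      have : Continuous (fun s : ℝ => iteratedFDeriv ℝ n g (x + s • a) t) :=
        (ContinuousMultilinearMap.apply ℝ (fun _ : Fin n => E) E t).continuous.comp
          (hc.comp (by fun_prop))
      exact this.inner continuous_const
    rw [hasDerivAt_iff_tendsto_slope]
    have h0 := (hc2.tendsto 0).mono_left (nhdsWithin_le_nhds (s := {0}ᶜ))
    simp only [zero_smul, add_zero] at h0
    refine h0.congr' ?_
    filter_upwards [self_mem_nhdsWithin] with s hs
    have hs : s ≠ 0 := hs
    simp [slope_def_field, inner_smul_right]
    field_simp
  have h5 := h1.unique ((h2.add h3).congr_of_eventuallyEq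
    (Filter.Eventually.of_forall fun s => by
      simp [dg_formula H g x n (hH.of_le (by simp)) hg h n le_rfl]))
  rw [h5]
  simp [dgRem]

theorem dg_perm {E : Type*} {n : ℕ} (v : Fin n → E) (u : E) (m : Fin n) :
    ∃ σ : Equiv.Perm (Fin n),
      (m.castSucc.removeNth (Fin.snoc v u : Fin (n + 1) → E) : Fin n → E)
        = Function.update v m u ∘ σ := by
  let τ : Fin (n + 1) → Fin n := Fin.lastCases m id
  have hinj : Function.Injective (fun i : Fin n => τ (m.castSucc.succAbove i)) := by
    intro i j hij
    have key : ∀ p q : Fin (n + 1), p ≠ m.castSucc → q ≠ m.castSucc → τ p = τ q → p = q := by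
      intro p q
      induction p using Fin.lastCases <;> induction q using Fin.lastCases <;>
        simp [τ] <;> grind
    exact Fin.succAbove_right_injective
      (key _ _ (Fin.succAbove_ne _ _) (Fin.succAbove_ne _ _) hij)
  refine ⟨Equiv.ofBijective _ (Finite.injective_iff_bijective.mp hinj), ?_⟩
  funext i
  have key : ∀ p : Fin (n + 1), p ≠ m.castSucc →
      (Fin.snoc v u : Fin (n + 1) → E) p = Function.update v m u (τ p) := by
    intro p
    induction p using Fin.lastCases with
    | last => simp [τ]
    | cast i =>
      intro hp
      have : i ≠ m := fun h => hp (by rw [h])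
      simp [τ, this]
  exact key _ (Fin.succAbove_ne _ _)

/-- For a discrete gradient `ḡ` of a `C^{κ+1}` function `H`, `C^κ` in its
second argument, the κ-th derivatives of `∇H` are expressed through those of `ḡ`:
`⟨D^κ∇H(x)(v₁,…,v_κ), u⟩ = ⟨D₂^κḡ(x,x)(v₁,…,v_κ), u⟩
  + Σₘ ⟨D₂^κḡ(x,x)(v₁,…,v_{m−1},u,v_{m+1},…,v_κ), vₘ⟩`. -/
theorem discrete_gradient_derivative_sum_relation
    (d κ : ℕ) (hκ : 1 ≤ κ)
    (H : EuclideanSpace ℝ (Fin d) → ℝ) (hH : ContDiff ℝ (κ + 1) H)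
    (g : EuclideanSpace ℝ (Fin d) → EuclideanSpace ℝ (Fin d) → EuclideanSpace ℝ (Fin d))
    (hdg : ∀ x y, ⟪g x y, y - x⟫ = H y - H x)
    (hgk : ∀ x, ContDiff ℝ κ (g x)) :
    ∀ (x u : EuclideanSpace ℝ (Fin d)) (v : Fin κ → EuclideanSpace ℝ (Fin d)),
      ⟪iteratedFDeriv ℝ κ (gradient H) x v, u⟫ =
        ⟪iteratedFDeriv ℝ κ (g x) x v, u⟫ +
          ∑ m : Fin κ, ⟪iteratedFDeriv ℝ κ (g x) x (Function.update v m u), v m⟫ := by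
  intro x u v
  have hL : ⟪iteratedFDeriv ℝ κ (gradient H) x v, u⟫
      = iteratedFDeriv ℝ (κ + 1) H x (Fin.snoc v u) := by
    have e : gradient H = (InnerProductSpace.toDual ℝ (EuclideanSpace ℝ (Fin d))).symm ∘ fderiv ℝ H := rfl
    have e2 := ContinuousLinearEquiv.iteratedFDeriv_comp_left (f := fderiv ℝ H) (x := x) (i := κ)
      (InnerProductSpace.toDual ℝ (EuclideanSpace ℝ (Fin d))).symm.toContinuousLinearEquiv
    rw [LinearIsometryEquiv.coe_toContinuousLinearEquiv] at e2
    rw [e, e2, iteratedFDeriv_succ_apply_right]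
    simp
  rw [hL, dg_top H (g x) x κ hH (hgk x) (hdg x), Fin.sum_univ_castSucc, add_comm]
  congr 1
  · have : ((Fin.last κ).removeNth (Fin.snoc v u : Fin (κ + 1) → EuclideanSpace ℝ (Fin d))) = v := by
      funext i; simp [Fin.removeNth]
    rw [this]; simp
  · refine Finset.sum_congr rfl fun m _ => ?_
    obtain ⟨σ, hσ⟩ := dg_perm v u m
    rw [hσ, dg_symm (g x) κ (hgk x) σ]
    simp
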